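/- Fix integers a, b, B ≥ 1 and define β(a,b) = (B!^{2a}/(2πi)^{2a}) ∫_{(1)} ⋯ ∫_{(1)} ∏_{i,j=1}^{a} (s_i + s_{a+j})^{-1/b²} ∏_{ℓ=1}^{2a} e^{s_ℓ} s_ℓ^{-(B+1)} ds_ℓ, the 2a integrals being over the vertical lines Re(s_ℓ) = 1, with principal-branch fractional powers. Then β(a,b) = Γ(1/b²)^{-a²} ∫_{𝒫_{a,b}} ∏_{i=1}^{a} (1 - ∑_{j=1}^{a} x_{ij})^B ∏_{j=1}^{a} (1 - ∑_{i=1}^{a} x_{ij})^B ∏_{i,j=1}^{a} x_{ij}^{1/b² - 1} dx_{ij}, where 𝒫_{a,b} = { (x_{ij}) ∈ ℝ^{a²} : x_{ij} ≥ 0, ∑_{i=1}^{a} x_{ij} ≤ 1 for each j, ∑_{j=1}^{a} x_{ij} ≤ 1 for each i }. In particular β(a,b) > 0. -/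

import Mathlib

open Complex Filter

/-- The combinatorial constant
`β(a,b) = (B!^{2a}/(2πi)^{2a}) ∫_{(1)^{2a}} ∏_{i,j} (s_i+s_{a+j})^{-1/b²}
  ∏_ℓ e^{s_ℓ} s_ℓ^{-(B+1)} ds_ℓ`,
the vertical-line integrals being parametrised by `s_ℓ = 1 + i t_ℓ`. -/
noncomputable def betaConst (a b B : ℕ) : ℂ :=
  ((Nat.factorial B : ℂ) ^ (2 * a) / (2 * Real.pi * I) ^ (2 * a)) * I ^ (2 * a) *
    ∫ t : Fin (2 * a) → ℝ,
      (∏ i : Fin a, ∏ j : Fin a,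
          ((1 + t ⟨i, by have := i.isLt; omega⟩ * I) +
              (1 + t ⟨a + j, by have := j.isLt; omega⟩ * I)) ^ (-(1 / (b : ℂ) ^ 2))) *
        ∏ ℓ : Fin (2 * a), Complex.exp (1 + t ℓ * I) * (1 + t ℓ * I) ^ (-(B + 1 : ℤ))

/-- The polytope `𝒫_{a,b} = {(x_{ij}) : x_{ij} ≥ 0, ∑_i x_{ij} ≤ 1, ∑_j x_{ij} ≤ 1}`. -/
def polytope (a : ℕ) : Set (Fin a → Fin a → ℝ) :=
  {x | (∀ i j, 0 ≤ x i j) ∧ (∀ j, ∑ i, x i j ≤ 1) ∧ (∀ i, ∑ j, x i j ≤ 1)}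

/-- The weighted volume
`Γ(1/b²)^{-a²} ∫_{𝒫_{a,b}} ∏_i (1-∑_j x_{ij})^B ∏_j (1-∑_i x_{ij})^B ∏_{i,j} x_{ij}^{1/b²-1} dx`. -/
noncomputable def polytopeIntegral (a b B : ℕ) : ℝ :=
  (1 / Real.Gamma (1 / (b : ℝ) ^ 2)) ^ (a ^ 2) *
    ∫ x in polytope a,
      (∏ i, (1 - ∑ j, x i j) ^ B) * (∏ j, (1 - ∑ i, x i j) ^ B) *
        ∏ i, ∏ j, x i j ^ (1 / (b : ℝ) ^ 2 - 1)

/-- The function `x ↦ x ^ (α - 1)` on `[0, ∞)`, extended by zero. -/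
noncomputable def truncRpow (α x : ℝ) : ℝ := (Set.Ici 0).indicator (fun x => x ^ (α - 1)) x

lemma truncRpow_of_nonneg (α : ℝ) {x : ℝ} (hx : 0 ≤ x) : truncRpow α x = x ^ (α - 1) :=
  Set.indicator_of_mem (s := Set.Ici (0 : ℝ)) hx _

lemma truncRpow_of_neg (α : ℝ) {x : ℝ} (hx : x < 0) : truncRpow α x = 0 :=
  Set.indicator_of_notMem (s := Set.Ici (0 : ℝ)) (by simpa using hx) _

lemma truncRpow_nonneg (α x : ℝ) : 0 ≤ truncRpow α x :=
  Set.indicator_nonneg (fun _ hx => Real.rpow_nonneg hx _) _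

@[fun_prop]
lemma measurable_truncRpow (α : ℝ) : Measurable (truncRpow α) :=
  (measurable_id.pow_const (α - 1)).indicator measurableSet_Ici

lemma truncRpow_natCast_add_one {B : ℕ} (hB : 1 ≤ B) (x : ℝ) :
    truncRpow (B + 1) x = max x 0 ^ B := by
  rcases le_or_gt 0 x with hx | hx
  · rw [truncRpow_of_nonneg _ hx, max_eq_left hx, add_sub_cancel_right, Real.rpow_natCast]
  · rw [truncRpow_of_neg _ hx, max_eq_right hx.le, zero_pow (by omega)]

lemma truncRpow_mul_eq_indicator (α r : ℝ) :
    (fun x => truncRpow α x * Real.exp (-(r * x))) =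
      (Set.Ici 0).indicator fun x => x ^ (α - 1) * Real.exp (-(r * x)) := by
  ext x
  exact (Set.indicator_mul_left (Set.Ici (0 : ℝ)) (fun x => x ^ (α - 1))
    fun x => Real.exp (-(r * x))).symm

lemma integrable_truncRpow_mul_exp {α r : ℝ} (hα : 0 < α) (hr : 0 < r) :
    MeasureTheory.Integrable fun x => truncRpow α x * Real.exp (-(r * x)) := by
  rw [truncRpow_mul_eq_indicator, MeasureTheory.integrable_indicator_iff measurableSet_Ici,
    integrableOn_Ici_iff_integrableOn_Ioi]
  simpa using integrableOn_rpow_mul_exp_neg_mul_rpow (s := α - 1) (by linarith) one_pos hr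

lemma integral_truncRpow_mul_exp {α r : ℝ} (hα : 0 < α) (hr : 0 < r) :
    ∫ x, truncRpow α x * Real.exp (-(r * x)) = (1 / r) ^ α * Real.Gamma α := by
  rw [truncRpow_mul_eq_indicator, MeasureTheory.integral_indicator measurableSet_Ici,
    MeasureTheory.integral_Ici_eq_integral_Ioi, Real.integral_rpow_mul_exp_neg_mul_Ioi hα hr]

lemma norm_truncRpow_mul_cexp (α : ℝ) (s : ℂ) (x : ℝ) :
    ‖(truncRpow α x : ℂ) * cexp (-(s * x))‖ = truncRpow α x * Real.exp (-(s.re * x)) := by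
  rw [norm_mul, Complex.norm_real, Real.norm_of_nonneg (truncRpow_nonneg _ _), Complex.norm_exp]
  simp

lemma integrable_truncRpow_mul_cexp {α : ℝ} (hα : 0 < α) {s : ℂ} (hs : 0 < s.re) :
    MeasureTheory.Integrable fun x : ℝ => (truncRpow α x : ℂ) * cexp (-(s * x)) := by
  refine (integrable_truncRpow_mul_exp hα hs).mono' ?_ (.of_forall fun x => ?_)
  · exact Measurable.aestronglyMeasurable (by fun_prop)
  · exact (norm_truncRpow_mul_cexp α s x).le

/-- The Laplace transform of `x ^ (α - 1)` on the right half-plane. -/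
lemma integral_truncRpow_mul_cexp {α : ℝ} (hα : 0 < α) {s : ℂ} (hs : 0 < s.re) :
    ∫ x : ℝ, (truncRpow α x : ℂ) * cexp (-(s * x)) = Real.Gamma α * s ^ (-(α : ℂ)) := by
  set μ : MeasureTheory.Measure ℝ :=
    MeasureTheory.volume.withDensity fun x => ((truncRpow α x).toNNReal : ENNReal) with hμ
  have hmeas : Measurable fun x => (truncRpow α x).toNNReal := by fun_prop
  have hset : ∀ r : ℝ, r < 0 → r ∈ ProbabilityTheory.integrableExpSet id μ := fun r hr => by
    change MeasureTheory.Integrable (fun x : ℝ => Real.exp (r * x)) μ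
    rw [hμ, MeasureTheory.integrable_withDensity_iff_integrable_coe_smul hmeas]
    simpa [truncRpow_nonneg] using integrable_truncRpow_mul_exp hα (neg_pos.2 hr)
  have hmgf : ∀ z : ℂ, ProbabilityTheory.complexMGF id μ (-z) =
      ∫ x : ℝ, (truncRpow α x : ℂ) * cexp (-(z * x)) := fun z => by
    rw [ProbabilityTheory.complexMGF, hμ,
      integral_withDensity_eq_integral_smul hmeas]
    simp [NNReal.smul_def, truncRpow_nonneg]
  have hopen : IsOpen {z : ℂ | 0 < z.re} := isOpen_lt continuous_const Complex.continuous_re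
  have hf : AnalyticOnNhd ℂ (fun z : ℂ => ∫ x : ℝ, (truncRpow α x : ℂ) * cexp (-(z * x)))
      {z | 0 < z.re} := by
    simp_rw [← hmgf]
    refine ProbabilityTheory.analyticOnNhd_complexMGF.comp analyticOnNhd_id.neg fun z hz => ?_
    refine mem_interior.2 ⟨Set.Iio 0, hset, isOpen_Iio, ?_⟩
    simpa using hz
  have hg : AnalyticOnNhd ℂ (fun z : ℂ => Real.Gamma α * z ^ (-(α : ℂ))) {z | 0 < z.re} := by
    refine DifferentiableOn.analyticOnNhd (fun z hz => ?_) hopen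
    exact ((differentiableAt_id.cpow_const (Or.inl hz)).const_mul _).differentiableWithinAt
  have hreal : ∀ r : ℝ, 0 < r → ∫ x : ℝ, (truncRpow α x : ℂ) * cexp (-((r : ℂ) * x)) =
      Real.Gamma α * (r : ℂ) ^ (-(α : ℂ)) := fun r hr => by
    have h := congrArg (fun y : ℝ => (y : ℂ)) (integral_truncRpow_mul_exp hα hr)
    simp only [← integral_complex_ofReal] at h
    push_cast at h
    rw [h, mul_comm, ← Complex.ofReal_neg, ← Complex.ofReal_cpow hr.le, Real.rpow_neg hr.le]
    norm_num [Real.inv_rpow hr.le, Complex.ofReal_cpow hr.le]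
  refine hf.eqOn_of_preconnected_of_frequently_eq hg
    (convex_halfSpace_re_gt 0).isPreconnected (z₀ := 1) (by simp) ?_ hs
  have ht : Tendsto (fun r : ℝ => (r : ℂ)) (nhdsWithin 1 {1}ᶜ) (nhdsWithin 1 {1}ᶜ) := by
    refine tendsto_nhdsWithin_iff.2 ⟨?_, ?_⟩
    · exact (by simpa using Complex.continuous_ofReal.tendsto (1 : ℝ) :
        Tendsto (fun r : ℝ => (r : ℂ)) (nhds 1) (nhds 1)).mono_left nhdsWithin_le_nhds
    · filter_upwards [self_mem_nhdsWithin] with r hr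
      simpa using hr
  refine ht.frequently (Eventually.frequently ?_)
  filter_upwards [nhdsWithin_le_nhds (lt_mem_nhds (one_pos : (0 : ℝ) < 1))] with r hr
  exact hreal r hr

lemma one_add_mul_I_re (t : ℝ) : (1 + t * I : ℂ).re = 1 := by simp

lemma one_add_mul_I_ne_zero (t : ℝ) : (1 + t * I : ℂ) ≠ 0 := fun h => by
  simpa using congrArg Complex.re h

lemma norm_one_add_mul_I_zpow_le {B : ℕ} (hB : 1 ≤ B) (t : ℝ) :
    ‖(1 + t * I : ℂ) ^ (-(B + 1 : ℤ))‖ ≤ (1 + t ^ 2)⁻¹ := by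
  have hsq : ‖(1 + t * I : ℂ)‖ ^ 2 = 1 + t ^ 2 := by
    rw [Complex.sq_norm, Complex.normSq_apply]; simp; ring
  have h1 : 1 ≤ ‖(1 + t * I : ℂ)‖ := by nlinarith [norm_nonneg (1 + t * I : ℂ), sq_nonneg t]
  rw [zpow_neg, norm_inv, ← hsq]
  refine inv_anti₀ (by positivity) ?_
  rw [← Nat.cast_succ, zpow_natCast, norm_pow]
  exact pow_le_pow_right₀ h1 (by omega)

@[fun_prop]
lemma continuous_one_add_mul_I_zpow (B : ℕ) :
    Continuous fun t : ℝ => (1 + t * I : ℂ) ^ (-(B + 1 : ℤ)) :=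
  Continuous.zpow₀ (by fun_prop) _ fun t => Or.inl (one_add_mul_I_ne_zero t)

lemma integrable_one_add_mul_I_zpow {B : ℕ} (hB : 1 ≤ B) :
    MeasureTheory.Integrable fun t : ℝ => (1 + t * I : ℂ) ^ (-(B + 1 : ℤ)) :=
  integrable_inv_one_add_sq.mono' (continuous_one_add_mul_I_zpow B).aestronglyMeasurable
    (.of_forall (norm_one_add_mul_I_zpow_le hB))

open FourierTransform in
/-- Laplace inversion for `s ^ (-(B + 1))` along the line `Re s = 1`. -/
lemma integral_cexp_mul_one_add_mul_I_zpow {B : ℕ} (hB : 1 ≤ B) (u : ℝ) :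
    ∫ t : ℝ, cexp ((1 + t * I) * u) * (1 + t * I) ^ (-(B + 1 : ℤ)) =
      2 * Real.pi / B.factorial * (max u 0 : ℝ) ^ B := by
  have hpos : (0 : ℝ) < B + 1 := by positivity
  set f : ℝ → ℂ := fun x => (truncRpow (B + 1) x : ℂ) * cexp (-((1 : ℂ) * x)) with hf
  have hcont : Continuous f := by
    simp only [hf, truncRpow_natCast_add_one hB]
    fun_prop
  have hint : MeasureTheory.Integrable f := integrable_truncRpow_mul_cexp hpos (by simp)
  have hfour : 𝓕 f = fun ξ : ℝ =>
      (B.factorial : ℂ) * (1 + ((2 * Real.pi * ξ : ℝ) : ℂ) * I) ^ (-(B + 1 : ℤ)) := by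
    ext ξ
    have h := integral_truncRpow_mul_cexp hpos
      (s := 1 + ((2 * Real.pi * ξ : ℝ) : ℂ) * I) (by rw [one_add_mul_I_re]; exact one_pos)
    rw [Real.Gamma_nat_eq_factorial] at h
    rw [Real.fourier_real_eq_integral_exp_smul]
    convert! h using 1
    · congr 1
      ext x
      simp only [hf, smul_eq_mul]
      rw [mul_left_comm, ← Complex.exp_add]
      congr 2
      push_cast
      ring
    · rw [← Complex.cpow_intCast]
      push_cast
      rfl
  have hfint : MeasureTheory.Integrable (𝓕 f) := by
    rw [hfour]
    exact ((integrable_one_add_mul_I_zpow hB).comp_mul_left' (by positivity)).const_mul _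
  have hinv := congrFun (hcont.fourierInv_fourier_eq hint hfint) u
  rw [Real.fourierInv_eq', hfour] at hinv
  have hscale := MeasureTheory.Measure.integral_comp_mul_left
    (fun t : ℝ => cexp (t * u * I) * ((B.factorial : ℂ) * (1 + t * I) ^ (-(B + 1 : ℤ))))
    (2 * Real.pi)
  have hfac : (B.factorial : ℂ) ≠ 0 := by exact_mod_cast B.factorial_ne_zero
  have hpi : (Real.pi : ℂ) ≠ 0 := by exact_mod_cast Real.pi_ne_zero
  have key : ∫ t : ℝ, cexp (t * u * I) * ((B.factorial : ℂ) * (1 + t * I) ^ (-(B + 1 : ℤ))) =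
      2 * Real.pi * f u := by
    have h2 : f u = ((|(2 * Real.pi)⁻¹| : ℝ) : ℂ) * ∫ t : ℝ, cexp (t * u * I) *
        ((B.factorial : ℂ) * (1 + t * I) ^ (-(B + 1 : ℤ))) := by
      rw [← hinv, ← Complex.real_smul, ← hscale]
      congr 1
      ext x
      simp only [smul_eq_mul]
      congr 2
      simp
      ring
    rw [h2, abs_of_pos (by positivity)]
    generalize ∫ t : ℝ, cexp (t * u * I) * ((B.factorial : ℂ) * (1 + t * I) ^ (-(B + 1 : ℤ))) = J
    push_cast
    field_simp
  calc _ = ∫ t : ℝ, (cexp u / B.factorial) *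
        (cexp (t * u * I) * ((B.factorial : ℂ) * (1 + t * I) ^ (-(B + 1 : ℤ)))) := by
        congr 1
        ext t
        rw [show (1 + t * I) * (u : ℂ) = u + t * u * I by ring, Complex.exp_add]
        field_simp
    _ = _ := by
        rw [MeasureTheory.integral_const_mul, key, hf]
        simp only [truncRpow_natCast_add_one hB, one_mul, Complex.exp_neg]
        have := Complex.exp_ne_zero (u : ℂ)
        push_cast
        field_simp

lemma prod_fin_two_mul {M : Type*} [CommMonoid M] {a : ℕ} (f : Fin (2 * a) → M) :
    ∏ ℓ, f ℓ = (∏ i : Fin a, f ⟨i, by omega⟩) * ∏ j : Fin a, f ⟨a + j, by omega⟩ := by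
  rw [← (finCongr (two_mul a).symm).prod_comp, Fin.prod_univ_add]
  rfl

/-- The row sums of a square matrix followed by its column sums. -/
def marginal {a : ℕ} (x : Fin a → Fin a → ℝ) (ℓ : Fin (2 * a)) : ℝ :=
  if h : (ℓ : ℕ) < a then ∑ j, x ⟨ℓ, h⟩ j else ∑ i, x i ⟨ℓ - a, by omega⟩

lemma marginal_row {a : ℕ} (x : Fin a → Fin a → ℝ) (i : Fin a) (h : (i : ℕ) < 2 * a) :
    marginal x ⟨i, h⟩ = ∑ j, x i j := by
  simp [marginal]

lemma marginal_column {a : ℕ} (x : Fin a → Fin a → ℝ) (j : Fin a) (h : a + (j : ℕ) < 2 * a) :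
    marginal x ⟨a + j, h⟩ = ∑ i, x i j := by
  simp [marginal]

/-- The integrand obtained by expanding every factor `(s_i + s_{a+j})^{-α}` as a Laplace
transform. -/
noncomputable def laplaceKernel (α : ℝ) (a B : ℕ) (t : Fin (2 * a) → ℝ)
    (x : Fin a → Fin a → ℝ) : ℂ :=
  (∏ i : Fin a, ∏ j : Fin a, (truncRpow α (x i j) : ℂ) *
      cexp (-(((1 + t ⟨i, by omega⟩ * I) + (1 + t ⟨a + j, by omega⟩ * I)) * x i j))) *
    ∏ ℓ, cexp (1 + t ℓ * I) * (1 + t ℓ * I) ^ (-(B + 1 : ℤ))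

lemma prod_cexp_eq_prod_cexp_marginal {a : ℕ} (s : Fin (2 * a) → ℂ) (x : Fin a → Fin a → ℝ) :
    ∏ i : Fin a, ∏ j : Fin a, cexp (-((s ⟨i, by omega⟩ + s ⟨a + j, by omega⟩) * x i j)) =
      ∏ ℓ, cexp (-(s ℓ * marginal x ℓ)) := by
  rw [prod_fin_two_mul]
  simp only [marginal_row, marginal_column, add_mul, neg_add, Complex.exp_add,
    Finset.prod_mul_distrib]
  congr 1
  · simp [← Complex.exp_sum, Finset.mul_sum]
  · rw [Finset.prod_comm]
    simp [← Complex.exp_sum, Finset.mul_sum]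

lemma laplaceKernel_eq (α : ℝ) (a B : ℕ) (t : Fin (2 * a) → ℝ) (x : Fin a → Fin a → ℝ) :
    laplaceKernel α a B t x = (∏ i, ∏ j, (truncRpow α (x i j) : ℂ)) *
      ∏ ℓ, cexp ((1 + t ℓ * I) * (1 - marginal x ℓ : ℝ)) * (1 + t ℓ * I) ^ (-(B + 1 : ℤ)) := by
  simp only [laplaceKernel, Finset.prod_mul_distrib]
  rw [prod_cexp_eq_prod_cexp_marginal (fun ℓ => 1 + t ℓ * I), mul_assoc]
  congr 1
  rw [← mul_assoc, ← Finset.prod_mul_distrib]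
  congr 1
  refine Finset.prod_congr rfl fun ℓ _ => ?_
  rw [← Complex.exp_add]
  congr 1
  push_cast
  ring

lemma measurable_laplaceKernel (α : ℝ) (a B : ℕ) :
    Measurable fun p : (Fin (2 * a) → ℝ) × (Fin a → Fin a → ℝ) =>
      laplaceKernel α a B p.1 p.2 := by
  have h := (continuous_one_add_mul_I_zpow B).measurable
  have hx : ∀ i j, Measurable fun p : (Fin (2 * a) → ℝ) × (Fin a → Fin a → ℝ) => p.2 i j :=
    fun i j => by fun_prop
  have ht : ∀ ℓ, Measurable fun p : (Fin (2 * a) → ℝ) × (Fin a → Fin a → ℝ) =>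
      (1 + p.1 ℓ * I : ℂ) ^ (-(B + 1 : ℤ)) := fun ℓ => h.comp (by fun_prop)
  unfold laplaceKernel
  fun_prop

lemma integrable_laplaceKernel {α : ℝ} (hα : 0 < α) (a : ℕ) {B : ℕ} (hB : 1 ≤ B) :
    MeasureTheory.Integrable (fun p : (Fin (2 * a) → ℝ) × (Fin a → Fin a → ℝ) =>
      laplaceKernel α a B p.1 p.2) := by
  have hx : MeasureTheory.Integrable fun x : Fin a → Fin a → ℝ =>
      ∏ i, ∏ j, truncRpow α (x i j) * Real.exp (-(2 * x i j)) :=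
    .fintype_prod (f := fun _ (y : Fin a → ℝ) => ∏ j, truncRpow α (y j) * Real.exp (-(2 * y j)))
      fun _ => .fintype_prod (f := fun _ (z : ℝ) => truncRpow α z * Real.exp (-(2 * z)))
        fun _ => integrable_truncRpow_mul_exp hα two_pos
  have ht : MeasureTheory.Integrable fun t : Fin (2 * a) → ℝ =>
      ∏ ℓ, Real.exp 1 * (1 + t ℓ ^ 2)⁻¹ :=
    .fintype_prod (f := fun _ (u : ℝ) => Real.exp 1 * (1 + u ^ 2)⁻¹)
      fun _ => integrable_inv_one_add_sq.const_mul _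
  refine (ht.mul_prod hx).mono' (measurable_laplaceKernel α a B).aestronglyMeasurable
    (.of_forall fun p => ?_)
  rw [laplaceKernel, norm_mul, mul_comm, norm_prod, norm_prod]
  simp only [norm_prod, norm_truncRpow_mul_cexp]
  refine mul_le_mul ?_ (le_of_eq ?_) ?_ ?_
  · refine Finset.prod_le_prod (fun _ _ => norm_nonneg _) fun ℓ _ => ?_
    rw [norm_mul, Complex.norm_exp, one_add_mul_I_re]
    exact mul_le_mul_of_nonneg_left (norm_one_add_mul_I_zpow_le hB _) (Real.exp_pos _).le
  · simp only [Complex.add_re]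
    norm_num
  · exact Finset.prod_nonneg fun i _ => Finset.prod_nonneg fun j _ =>
      mul_nonneg (truncRpow_nonneg _ _) (Real.exp_pos _).le
  · positivity

/-- The weight integrated over `polytope a`. -/
noncomputable def polytopeWeight (α : ℝ) (a B : ℕ) (x : Fin a → Fin a → ℝ) : ℝ :=
  (∏ i, (1 - ∑ j, x i j) ^ B) * (∏ j, (1 - ∑ i, x i j) ^ B) * ∏ i, ∏ j, x i j ^ (α - 1)

lemma indicator_polytopeWeight (α : ℝ) (a : ℕ) {B : ℕ} (hB : 1 ≤ B) (x : Fin a → Fin a → ℝ) :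
    (polytope a).indicator (polytopeWeight α a B) x =
      (∏ ℓ, max (1 - marginal x ℓ) 0 ^ B) * ∏ i, ∏ j, truncRpow α (x i j) := by
  have hB0 : B ≠ 0 := by omega
  rw [prod_fin_two_mul]
  simp only [marginal_row, marginal_column]
  by_cases hx : x ∈ polytope a
  · rw [Set.indicator_of_mem hx, polytopeWeight]
    obtain ⟨h0, hcol, hrow⟩ := hx
    congr 1
    · congr 1
      · exact Finset.prod_congr rfl fun i _ => by rw [max_eq_left (by linarith [hrow i])]
      · exact Finset.prod_congr rfl fun j _ => by rw [max_eq_left (by linarith [hcol j])]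
    · simp only [truncRpow_of_nonneg _ (h0 _ _)]
  · rw [Set.indicator_of_notMem hx]
    symm
    by_cases h0 : ∀ i j, 0 ≤ x i j
    · by_cases hcol : ∀ j, ∑ i, x i j ≤ 1
      · obtain ⟨i, hi⟩ : ∃ i, 1 < ∑ j, x i j := by
          by_contra! hrow
          exact hx ⟨h0, hcol, hrow⟩
        rw [Finset.prod_eq_zero (Finset.mem_univ i)
          (by rw [max_eq_right (by linarith), zero_pow hB0])]
        simp
      · push Not at hcol
        obtain ⟨j, hj⟩ := hcol
        rw [Finset.prod_eq_zero (f := fun j => max (1 - ∑ i, x i j) 0 ^ B) (Finset.mem_univ j)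
          (by rw [max_eq_right (by linarith), zero_pow hB0])]
        simp
    · push Not at h0
      obtain ⟨i, j, hij⟩ := h0
      rw [Finset.prod_eq_zero (f := fun i => ∏ j, truncRpow α (x i j)) (Finset.mem_univ i)
        (Finset.prod_eq_zero (Finset.mem_univ j) (truncRpow_of_neg α hij)), mul_zero]

lemma integral_laplaceKernel_left (α : ℝ) (a : ℕ) {B : ℕ} (hB : 1 ≤ B)
    (x : Fin a → Fin a → ℝ) :
    ∫ t, laplaceKernel α a B t x = (2 * Real.pi / B.factorial) ^ (2 * a) *
      ((polytope a).indicator (polytopeWeight α a B) x : ℝ) := by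
  simp only [laplaceKernel_eq]
  rw [MeasureTheory.integral_const_mul, MeasureTheory.integral_fintype_prod_volume_eq_prod
    (fun ℓ (t : ℝ) => cexp ((1 + t * I) * (1 - marginal x ℓ : ℝ)) * (1 + t * I) ^ (-(B + 1 : ℤ)))]
  simp only [integral_cexp_mul_one_add_mul_I_zpow hB, Finset.prod_mul_distrib, Finset.prod_const,
    Finset.card_univ, Fintype.card_fin]
  rw [indicator_polytopeWeight α a hB]
  push_cast
  ring

lemma integral_laplaceKernel_right {α : ℝ} (hα : 0 < α) (a B : ℕ) (t : Fin (2 * a) → ℝ) :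
    ∫ x, laplaceKernel α a B t x = (Real.Gamma α : ℂ) ^ (a ^ 2) *
      ((∏ i : Fin a, ∏ j : Fin a,
        ((1 + t ⟨i, by omega⟩ * I) + (1 + t ⟨a + j, by omega⟩ * I)) ^ (-(α : ℂ))) *
        ∏ ℓ, cexp (1 + t ℓ * I) * (1 + t ℓ * I) ^ (-(B + 1 : ℤ))) := by
  simp only [laplaceKernel]
  rw [MeasureTheory.integral_mul_const, ← mul_assoc,
    MeasureTheory.integral_fintype_prod_volume_eq_prod (fun (i : Fin a) (y : Fin a → ℝ) =>
      ∏ j : Fin a, (truncRpow α (y j) : ℂ) *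
        cexp (-(((1 + t ⟨i, by omega⟩ * I) + (1 + t ⟨a + j, by omega⟩ * I)) * y j)))]
  have h : ∀ i : Fin a, ∫ y : Fin a → ℝ, ∏ j : Fin a, (truncRpow α (y j) : ℂ) *
        cexp (-(((1 + t ⟨i, by omega⟩ * I) + (1 + t ⟨a + j, by omega⟩ * I)) * y j)) =
      ∏ j : Fin a, (Real.Gamma α : ℂ) *
        ((1 + t ⟨i, by omega⟩ * I) + (1 + t ⟨a + j, by omega⟩ * I)) ^ (-(α : ℂ)) := fun i => by
    rw [MeasureTheory.integral_fintype_prod_volume_eq_prod (fun (j : Fin a) (y : ℝ) =>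
      (truncRpow α y : ℂ) *
        cexp (-(((1 + t ⟨i, by omega⟩ * I) + (1 + t ⟨a + j, by omega⟩ * I)) * y)))]
    refine Finset.prod_congr rfl fun j _ => integral_truncRpow_mul_cexp hα ?_
    simp only [Complex.add_re]
    norm_num
  rw [Finset.prod_congr rfl fun i _ => h i]
  simp only [Finset.prod_mul_distrib, Finset.prod_const, Finset.card_univ, Fintype.card_fin,
    ← pow_mul, ← sq]

lemma measurableSet_polytope (a : ℕ) : MeasurableSet (polytope a) := by
  refine IsClosed.measurableSet ?_
  simp only [polytope, Set.ofPred_and, Set.ofPred_forall]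
  refine .inter ?_ (.inter ?_ ?_)
  · exact isClosed_iInter fun i => isClosed_iInter fun j =>
      isClosed_le continuous_const (by fun_prop)
  · exact isClosed_iInter fun j => isClosed_le (by fun_prop) continuous_const
  · exact isClosed_iInter fun i => isClosed_le (by fun_prop) continuous_const

lemma integrableOn_polytopeWeight {α : ℝ} (hα : 0 < α) (a : ℕ) {B : ℕ} (hB : 1 ≤ B) :
    MeasureTheory.IntegrableOn (polytopeWeight α a B) (polytope a) := by
  rw [← MeasureTheory.integrable_indicator_iff (measurableSet_polytope a)]
  have h := (integrable_laplaceKernel hα a hB).integral_prod_right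
  simp only [integral_laplaceKernel_left α a hB] at h
  have hc : (2 * Real.pi / B.factorial : ℂ) ^ (2 * a) ≠ 0 := by
    simp [Real.pi_ne_zero, B.factorial_ne_zero]
  rw [MeasureTheory.integrable_const_mul_iff hc.isUnit] at h
  exact h.re

lemma setIntegral_polytopeWeight_pos {α : ℝ} (hα : 0 < α) (a : ℕ) {B : ℕ} (hB : 1 ≤ B) :
    0 < ∫ x in polytope a, polytopeWeight α a B x := by
  rw [MeasureTheory.setIntegral_pos_iff_support_of_nonneg_ae _
    (integrableOn_polytopeWeight hα a hB)]
  · set c : ℝ := 1 / (a + 1) with hc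
    have hc0 : 0 < c := by positivity
    let U : Set (Fin a → Fin a → ℝ) :=
      Set.pi Set.univ fun _ => Set.pi Set.univ fun _ => Set.Ioo 0 c
    have hU : IsOpen U := isOpen_set_pi Set.finite_univ fun _ _ =>
      isOpen_set_pi Set.finite_univ fun _ _ => isOpen_Ioo
    have hne : U.Nonempty :=
      ⟨fun _ _ => c / 2, fun _ _ _ _ => ⟨half_pos hc0, half_lt_self hc0⟩⟩
    have hsum : ∀ y : Fin a → ℝ, (∀ i, y i < c) → ∑ i, y i < 1 := fun y hy => by
      have h := Finset.sum_le_card_nsmul Finset.univ y c fun i _ => (hy i).le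
      have h1 : (a : ℝ) * c < 1 := by
        rw [hc, mul_one_div, div_lt_one (by positivity)]
        linarith
      simp only [Finset.card_univ, Fintype.card_fin, nsmul_eq_mul] at h
      linarith
    refine (hU.measure_pos MeasureTheory.volume hne).trans_le
      (MeasureTheory.measure_mono fun x hx => ?_)
    have hx' : ∀ i j, 0 < x i j ∧ x i j < c := fun i j => hx i trivial j trivial
    have hrow : ∀ i, ∑ j, x i j < 1 := fun i => hsum _ fun j => (hx' i j).2
    have hcol : ∀ j, ∑ i, x i j < 1 := fun j => hsum _ fun i => (hx' i j).2
    refine ⟨ne_of_gt ?_, fun i j => (hx' i j).1.le, fun j => (hcol j).le, fun i => (hrow i).le⟩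
    refine mul_pos (mul_pos ?_ ?_) ?_
    · exact Finset.prod_pos fun i _ => pow_pos (sub_pos.2 (hrow i)) _
    · exact Finset.prod_pos fun j _ => pow_pos (sub_pos.2 (hcol j)) _
    · exact Finset.prod_pos fun i _ => Finset.prod_pos fun j _ => Real.rpow_pos_of_pos (hx' i j).1 _
  · filter_upwards [MeasureTheory.ae_restrict_mem (measurableSet_polytope a)] with x hx
    obtain ⟨h0, hcol, hrow⟩ := hx
    refine mul_nonneg (mul_nonneg ?_ ?_) ?_
    · exact Finset.prod_nonneg fun i _ => pow_nonneg (sub_nonneg.2 (hrow i)) _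
    · exact Finset.prod_nonneg fun j _ => pow_nonneg (sub_nonneg.2 (hcol j)) _
    · exact Finset.prod_nonneg fun i _ => Finset.prod_nonneg fun j _ =>
        Real.rpow_nonneg (h0 i j) _

/-- The constant `β(a,b)` equals the weighted volume of the polytope `𝒫_{a,b}`;
in particular it is strictly positive. -/
theorem betaConst_eq_polytopeIntegral (a b B : ℕ) (ha : 0 < a) (hb : 0 < b) (hB : 1 ≤ B) :
    betaConst a b B = (polytopeIntegral a b B : ℂ) ∧ 0 < polytopeIntegral a b B := by
  set α : ℝ := 1 / (b : ℝ) ^ 2 with hα_def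
  have hα : 0 < α := by positivity
  have hΓ : 0 < Real.Gamma α := Real.Gamma_pos_of_pos hα
  have hpoly : polytopeIntegral a b B = (1 / Real.Gamma α) ^ (a ^ 2) *
    ∫ x in polytope a, polytopeWeight α a B x := rfl
  refine ⟨?_, ?_⟩
  · have hswap := MeasureTheory.integral_integral_swap
      (f := laplaceKernel α a B) (integrable_laplaceKernel hα a hB)
    simp only [integral_laplaceKernel_left α a hB, integral_laplaceKernel_right hα a B] at hswap
    rw [MeasureTheory.integral_const_mul, MeasureTheory.integral_const_mul,
      integral_complex_ofReal,
      MeasureTheory.integral_indicator (measurableSet_polytope a)] at hswap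
    rw [betaConst, hpoly, show (1 / (b : ℂ) ^ 2) = (α : ℂ) by rw [hα_def]; push_cast; rfl]
    have hΓ' : (Real.Gamma α : ℂ) ≠ 0 := by exact_mod_cast hΓ.ne'
    have hpi : (Real.pi : ℂ) ≠ 0 := by exact_mod_cast Real.pi_ne_zero
    have hfac : (B.factorial : ℂ) ≠ 0 := by exact_mod_cast B.factorial_ne_zero
    rw [mul_comm, ← eq_div_iff (pow_ne_zero _ hΓ')] at hswap
    rw [hswap, mul_pow _ I]
    generalize ∫ x in polytope a, polytopeWeight α a B x = J
    push_cast
    rw [div_pow, div_pow, one_pow]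
    field_simp
  · rw [hpoly]
    exact mul_pos (by positivity) (setIntegral_polytopeWeight_pos hα a hB)
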